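/- Let K be a field and (V, B) a symplectic K-vector space of dimension 2g. Then for every symplectic permutation π ∈ S_{2g} there exists a pair ((F_i), (G_j)) of complete symplectic flags in V whose relative position is π, i.e. dim_K(F_i ∩ G_j) = #{k ∈ {1,...,2g} : k ≤ i and π(k) ≤ j} for all 0 ≤ i, j ≤ 2g. (In particular, every orbit of pairs of complete symplectic flags under the symplectic group of V ⊗ K̄ contains a pair defined over K.) -/

import Mathlib

/-- The orthogonal of a submodule `N` with respect to a bilinear form `B`:
`N^⊥ = {x ∈ M : B(x, n) = 0 for all n ∈ N}`. -/
def bilinOrthogonal {R M : Type*} [CommRing R] [AddCommGroup M] [Module R M]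
    (B : M →ₗ[R] M →ₗ[R] R) (N : Submodule R M) : Submodule R M where
  carrier := {x | ∀ n ∈ N, B x n = 0}
  add_mem' := by
    intro a b ha hb n hn
    simp [map_add, ha n hn, hb n hn]
  zero_mem' := by
    intro n hn
    simp
  smul_mem' := by
    intro c x hx n hn
    simp [map_smul, hx n hn]

/-- In a nondegenerate alternating space of dimension at least `2 * n`, there are `n` pairwise
orthogonal hyperbolic pairs `(a i, b i)`. -/
theorem exists_hyperbolic_pairs {K V : Type*} [Field K] [AddCommGroup V] [Module K V]
    [FiniteDimensional K V] (B : V →ₗ[K] V →ₗ[K] K)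
    (halt : ∀ x, B x x = 0) (hnd : ∀ x, (∀ y, B x y = 0) → x = 0)
    (n : ℕ) (hn : 2 * n ≤ Module.finrank K V) :
    ∃ a b : ℕ → V, ∀ i < n, ∀ j < n, B (a i) (a j) = 0 ∧ B (b i) (b j) = 0 ∧
      B (a i) (b j) = if i = j then 1 else 0 := by
  have hskew : ∀ x y, B x y = -B y x := fun x y => by
    have h := halt (x + y)
    simp only [map_add, LinearMap.add_apply, halt] at h
    linear_combination h
  induction n with
  | zero => exact ⟨0, 0, by simp⟩
  | succ n ih =>
    obtain ⟨a, b, hab⟩ := ih (by omega)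
    let f : V →ₗ[K] (Fin n ⊕ Fin n → K) :=
      LinearMap.pi (Sum.elim (fun i => B (a i)) (fun i => B (b i)))
    have hker : f.ker ≠ ⊥ := LinearMap.ker_ne_bot_of_finrank_lt (by simp; omega)
    obtain ⟨x, hx, hx0⟩ := Submodule.exists_mem_ne_zero_of_ne_bot hker
    have hxa : ∀ i < n, B (a i) x = 0 := fun i hi =>
      congrFun (LinearMap.mem_ker.1 hx) (Sum.inl ⟨i, hi⟩)
    have hxb : ∀ i < n, B (b i) x = 0 := fun i hi =>
      congrFun (LinearMap.mem_ker.1 hx) (Sum.inr ⟨i, hi⟩)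
    obtain ⟨z, hz⟩ : ∃ z, B x z ≠ 0 := by
      by_contra! h
      exact hx0 (hnd x h)
    let w := (B x z)⁻¹ • z
    let y := w - ∑ i ∈ Finset.range n, (B (a i) w • b i - B (b i) w • a i)
    have hxy : B x y = 1 := by
      have hsum : ∑ i ∈ Finset.range n, B x (B (a i) w • b i - B (b i) w • a i) = 0 :=
        Finset.sum_eq_zero fun i hi => by
          have hi := Finset.mem_range.1 hi
          simp [hskew x (b i), hskew x (a i), hxa i hi, hxb i hi]
      simp only [y, map_sub, map_sum] at hsum ⊢
      rw [hsum]
      simp [w, hz]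
    have hya : ∀ i < n, B (a i) y = 0 := fun i hi => by
      have hsum : ∑ j ∈ Finset.range n, B (a i) (B (a j) w • b j - B (b j) w • a j) =
          ∑ j ∈ Finset.range n, if i = j then B (a j) w else 0 :=
        Finset.sum_congr rfl fun j hj => by
          obtain ⟨h1, -, h3⟩ := hab i hi j (Finset.mem_range.1 hj)
          simp [h1, h3]
      simp only [y]
      rw [map_sub, map_sum, hsum]
      simp [hi]
    have hyb : ∀ i < n, B (b i) y = 0 := fun i hi => by
      have hsum : ∑ j ∈ Finset.range n, B (b i) (B (a j) w • b j - B (b j) w • a j) =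
          ∑ j ∈ Finset.range n, if j = i then B (b j) w else 0 :=
        Finset.sum_congr rfl fun j hj => by
          obtain ⟨-, h2, -⟩ := hab i hi j (Finset.mem_range.1 hj)
          obtain ⟨-, -, h3⟩ := hab j (Finset.mem_range.1 hj) i hi
          simp [h2, hskew (b i) (a j), h3]
      simp only [y]
      rw [map_sub, map_sum, hsum]
      simp [hi]
    refine ⟨Function.update a n x, Function.update b n y, fun i hi j hj => ?_⟩
    rcases Nat.lt_succ_iff_lt_or_eq.1 hi with hi | rfl <;>
      rcases Nat.lt_succ_iff_lt_or_eq.1 hj with hj | rfl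
    · simpa [hi.ne, hj.ne] using hab i hi j hj
    · simp [hi.ne, hxa i hi, hya i hi, hyb i hi]
    · simp [hj.ne, hj.ne', hskew x (a j), hskew x (b j), hskew y (b j), hxa j hj, hxb j hj,
        hyb j hj]
    · simp [halt, hxy]

/-- A symplectic space of dimension `2 * g` has a basis in which the Gram matrix is supported
exactly on the antidiagonal. -/
theorem exists_antidiagonal_basis {K V : Type*} [Field K] [AddCommGroup V] [Module K V]
    [FiniteDimensional K V] (g : ℕ) (hdim : Module.finrank K V = 2 * g)
    (B : V →ₗ[K] V →ₗ[K] K)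
    (halt : ∀ x, B x x = 0) (hnd : ∀ x, (∀ y, B x y = 0) → x = 0) :
    ∃ v : Module.Basis (Fin (2 * g)) K V, ∀ i j, B (v i) (v j) ≠ 0 ↔ i = j.rev := by
  have hskew : ∀ x y, B x y = -B y x := fun x y => by
    have h := halt (x + y)
    simp only [map_add, LinearMap.add_apply, halt] at h
    linear_combination h
  obtain ⟨a, b, hab⟩ := exists_hyperbolic_pairs B halt hnd g hdim.ge
  let v : Fin (2 * g) → V := fun k => if (k : ℕ) < g then a k else b k.rev
  have hv : ∀ i j, B (v i) (v j) ≠ 0 ↔ i = j.rev := fun i j => by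
    have hi := i.isLt
    have hj := j.isLt
    have hir := Fin.val_rev i
    have hjr := Fin.val_rev j
    rw [Fin.ext_iff]
    by_cases h1 : (i : ℕ) < g <;> by_cases h2 : (j : ℕ) < g
    · simp only [v, h1, h2, if_true, (hab i h1 j h2).1]
      simp; omega
    · simp [v, h1, h2, (hab i h1 j.rev (by omega)).2.2, -Fin.val_rev]
    · simp only [v, h1, h2, if_true, if_false]
      rw [hskew, (hab j h2 i.rev (by omega)).2.2]
      simp [-Fin.val_rev]; omega
    · simp only [v, h1, h2, if_false, (hab i.rev (by omega) j.rev (by omega)).2.1]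
      simp; omega
  have hli : LinearIndependent K v := by
    rw [Fintype.linearIndependent_iff]
    intro c hc i
    have h := congrArg (B (v i.rev)) hc
    rw [map_sum, map_zero, Finset.sum_eq_single i] at h
    · rw [map_smul, smul_eq_mul] at h
      exact (mul_eq_zero.1 h).resolve_right ((hv _ _).2 rfl)
    · intro j _ hj
      rw [map_smul, not_ne_iff.1 (mt (hv _ _).1 fun h => hj (Fin.rev_injective h).symm), smul_zero]
    · simp
  refine ⟨basisOfLinearIndependentOfCardEqFinrank' v hli (by simp [hdim]), fun i j => ?_⟩
  simpa using hv i j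

/-- Coordinate subspaces intersect in the coordinate subspace of the intersection. -/
theorem Module.Basis.span_image_inf {ι K V : Type*} [Field K] [AddCommGroup V] [Module K V]
    (v : Module.Basis ι K V) (s t : Set ι) :
    Submodule.span K (v '' s) ⊓ Submodule.span K (v '' t) = Submodule.span K (v '' (s ∩ t)) := by
  ext x
  simp only [Submodule.mem_inf, v.mem_span_image, Set.subset_inter_iff]

/-- The dimension of a coordinate subspace. -/
theorem Module.Basis.finrank_span_image {ι K V : Type*} [Field K] [AddCommGroup V] [Module K V]
    (v : Module.Basis ι K V) (s : Finset ι) :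
    Module.finrank K (Submodule.span K (v '' (s : Set ι))) = s.card := by
  have h := finrank_span_eq_card (v.linearIndependent.comp ((↑) : s → ι) Subtype.val_injective)
  rw [Set.range_comp, Subtype.range_coe_subtype] at h
  simpa using h

/-- The orthogonal of a coordinate subspace, for an antidiagonal Gram matrix. -/
theorem bilinOrthogonal_span_image {n : ℕ} {K V : Type*} [Field K] [AddCommGroup V] [Module K V]
    (B : V →ₗ[K] V →ₗ[K] K) (v : Module.Basis (Fin n) K V)
    (hv : ∀ i j, B (v i) (v j) ≠ 0 ↔ i = j.rev) (s : Set (Fin n)) :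
    bilinOrthogonal B (Submodule.span K (v '' s)) = Submodule.span K (v '' {k | k.rev ∉ s}) := by
  have hB : ∀ x k, B x (v k) = v.repr x k.rev * B (v k.rev) (v k) := fun x k => by
    conv_lhs => rw [← v.sum_repr x]
    rw [map_sum, LinearMap.sum_apply, Finset.sum_eq_single k.rev]
    · simp
    · intro j _ hj
      simp [not_ne_iff.1 (mt (hv j k).1 hj)]
    · simp
  ext x
  have hmem : x ∈ bilinOrthogonal B (Submodule.span K (v '' s)) ↔ ∀ k ∈ s, B x (v k) = 0 := by
    refine ⟨fun h k hk => h _ (Submodule.subset_span ⟨k, hk, rfl⟩), fun h => ?_⟩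
    have hle : Submodule.span K (v '' s) ≤ (B x).ker :=
      Submodule.span_le.2 (by rintro _ ⟨k, hk, rfl⟩; exact h k hk)
    exact fun n hn => hle hn
  rw [hmem, v.mem_span_image]
  have hzero : ∀ k, B x (v k) = 0 ↔ v.repr x k.rev = 0 := fun k => by
    rw [hB, mul_eq_zero, or_iff_left ((hv _ _).2 rfl)]
  simp only [hzero]
  constructor
  · intro h k hk hks
    exact Finsupp.mem_support_iff.1 hk (by simpa using h _ hks)
  · intro h k hk
    by_contra hne
    exact h (Finsupp.mem_support_iff.2 hne) (by simpa using hk)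

/-- A permutation commuting with `Fin.rev` turns a basis with antidiagonal Gram matrix into a
complete symplectic flag. -/
theorem symplectic_flag_of_perm {n : ℕ} {K V : Type*} [Field K] [AddCommGroup V] [Module K V]
    (B : V →ₗ[K] V →ₗ[K] K) (v : Module.Basis (Fin n) K V)
    (hv : ∀ i j, B (v i) (v j) ≠ 0 ↔ i = j.rev)
    (σ : Equiv.Perm (Fin n)) (hσ : ∀ i, σ i.rev = (σ i).rev)
    (F : Fin (n + 1) → Submodule K V)
    (hF : ∀ i, F i = Submodule.span K (v '' {k | (σ k : ℕ) < (i : ℕ)})) :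
    Monotone F ∧ (∀ i, Module.finrank K (F i) = (i : ℕ)) ∧
      ∀ i, bilinOrthogonal B (F i) = F i.rev := by
  refine ⟨fun i j hij => ?_, fun i => ?_, fun i => ?_⟩
  · rw [hF, hF]
    refine Submodule.span_mono (Set.image_mono fun k hk => ?_)
    exact (show (σ k : ℕ) < i from hk).trans_le (Fin.le_def.1 hij)
  · have hs : {k | (σ k : ℕ) < (i : ℕ)} =
        ((Finset.univ.filter fun k : Fin n => (k : ℕ) < i).map σ.symm.toEmbedding :
          Finset (Fin n)) := by
      ext k
      simp
    rw [hF, hs, v.finrank_span_image, Finset.card_map, Fin.card_filter_val_lt]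
    exact min_eq_right (Nat.lt_succ_iff.1 i.isLt)
  · rw [hF, hF, bilinOrthogonal_span_image B v hv]
    congr 2
    ext k
    have hk := (σ k).isLt
    have hi := i.isLt
    simp only [Set.mem_ofPred_eq, hσ, Fin.val_rev]
    omega

/-- Let `(V, B)` be a symplectic `K`-vector space of dimension `2g`. Then
for every symplectic permutation `π ∈ S_{2g}` (in `0`-indexed form on `Fin (2*g)`, the
involution `i ↦ 2g+1-i` becoming `Fin.rev`) there is a pair `((F_i), (G_j))` of complete
symplectic flags in `V` whose relative position is `π`, i.e.
`dim (F_i ∩ G_j) = #{k : k ≤ i and π(k) ≤ j}` for all `i, j`. -/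
theorem flatness_stmt_14 (K V : Type*) [Field K] [AddCommGroup V] [Module K V]
    [FiniteDimensional K V] (g : ℕ) (hg : 1 ≤ g) (hdim : Module.finrank K V = 2*g)
    (B : V →ₗ[K] V →ₗ[K] K)
    (halt : ∀ x, B x x = 0) (hnd : ∀ x, (∀ y, B x y = 0) → x = 0)
    (π : Equiv.Perm (Fin (2*g))) (hπ : ∀ i, π i.rev = (π i).rev) :
    ∃ F G : Fin (2*g+1) → Submodule K V,
      Monotone F ∧ (∀ i, Module.finrank K (F i) = (i : ℕ)) ∧
      (∀ i, bilinOrthogonal B (F i) = F i.rev) ∧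
      Monotone G ∧ (∀ i, Module.finrank K (G i) = (i : ℕ)) ∧
      (∀ i, bilinOrthogonal B (G i) = G i.rev) ∧
      ∀ i j : Fin (2*g+1),
        Module.finrank K ↥(F i ⊓ G j) =
          (Finset.univ.filter fun k : Fin (2*g) =>
            (k : ℕ) < (i : ℕ) ∧ ((π k : Fin (2*g)) : ℕ) < (j : ℕ)).card := by
  obtain ⟨v, hv⟩ := exists_antidiagonal_basis g hdim B halt hnd
  obtain ⟨hF₁, hF₂, hF₃⟩ := symplectic_flag_of_perm B v hv 1 (fun _ => rfl) _ fun _ => rfl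
  obtain ⟨hG₁, hG₂, hG₃⟩ := symplectic_flag_of_perm B v hv π hπ _ fun _ => rfl
  refine ⟨_, _, hF₁, hF₂, hF₃, hG₁, hG₂, hG₃, fun i j => ?_⟩
  have hs : {k | ((1 : Equiv.Perm (Fin (2 * g))) k : ℕ) < (i : ℕ)} ∩ {k | (π k : ℕ) < (j : ℕ)} =
      (Finset.univ.filter fun k => (k : ℕ) < (i : ℕ) ∧ (π k : ℕ) < (j : ℕ) :
        Finset (Fin (2 * g))) := by
    ext k
    simp
  rw [v.span_image_inf, hs, v.finrank_span_image]
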